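/- Let ε = ε_n be a sequence of positive reals converging to 0. Then h⁻¹(log 2 − ε) = 1/2 + (1/√2)·√ε − (1/(6√2))·ε^{3/2} + O(ε^{5/2}). -/

import Mathlib

open Filter

noncomputable section

/-- The natural-log binary entropy function. -/
noncomputable def binEnt (x : ℝ) : ℝ := -(x * Real.log x) - (1 - x) * Real.log (1 - x)

/-- The inverse of the binary entropy restricted to `[1/2, 1]`. -/
noncomputable def binEntInv (y : ℝ) : ℝ :=
  Function.invFunOn binEnt (Set.Icc (1/2 : ℝ) 1) y

theorem binEnt_eq_binEntropy : binEnt = Real.binEntropy := by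
  funext x
  rw [binEnt, Real.binEntropy, Real.log_inv, Real.log_inv]
  ring

theorem exists_binEnt_eq {y : ℝ} (h0 : 0 ≤ y) (h1 : y ≤ Real.log 2) :
    ∃ x ∈ Set.Icc (1/2 : ℝ) 1, binEnt x = y := by
  have hc : ContinuousOn binEnt (Set.Icc (1/2 : ℝ) 1) := by
    rw [binEnt_eq_binEntropy]
    exact Real.binEntropy_continuous.continuousOn
  refine intermediate_value_Icc' (by norm_num) hc ?_
  rw [binEnt_eq_binEntropy, Real.binEntropy_one, one_div, Real.binEntropy_two_inv]
  exact ⟨h0, h1⟩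

theorem binEntInv_mem {y : ℝ} (h0 : 0 ≤ y) (h1 : y ≤ Real.log 2) :
    binEntInv y ∈ Set.Icc (1/2 : ℝ) 1 :=
  Function.invFunOn_mem (exists_binEnt_eq h0 h1)

theorem binEnt_binEntInv {y : ℝ} (h0 : 0 ≤ y) (h1 : y ≤ Real.log 2) :
    binEnt (binEntInv y) = y :=
  Function.invFunOn_eq (exists_binEnt_eq h0 h1)

/-- Fourth-order Taylor estimate of the binary entropy at `1/2`. -/
theorem abs_log_two_sub_binEnt_sub_le {t : ℝ} (h0 : 0 ≤ t) (h1 : t ≤ 1/2) :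
    |2 * (Real.log 2 - binEnt ((1 + t) / 2)) - t ^ 2 - t ^ 4 / 6| ≤ 5 * t ^ 6 := by
  have ht : |t| = t := abs_of_nonneg h0
  have key : t ^ 6 / (1 - t) ≤ 2 * t ^ 6 := by
    rw [div_le_iff₀ (by linarith)]
    nlinarith [pow_nonneg h0 6]
  have e1 := (Real.abs_log_sub_add_sum_range_le (x := t) (by rw [ht]; linarith) 5)
  have e2 := (Real.abs_log_sub_add_sum_range_le (x := -t) (by rw [abs_neg, ht]; linarith) 5)
  rw [abs_neg] at e2
  rw [ht] at e1 e2
  replace e1 := abs_le.1 (e1.trans key)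
  replace e2 := abs_le.1 (e2.trans key)
  simp only [Finset.sum_range_succ, Finset.sum_range_zero, sub_neg_eq_add] at e1 e2
  norm_num at e1 e2
  have hb : 2 * (Real.log 2 - binEnt ((1 + t) / 2)) =
      (1 + t) * Real.log (1 + t) + (1 - t) * Real.log (1 - t) := by
    rw [binEnt, show 1 - (1 + t) / 2 = (1 - t) / 2 by ring,
      Real.log_div (by linarith) (by norm_num), Real.log_div (by linarith) (by norm_num)]
    ring
  rw [hb]
  set A := Real.log (1 + t)
  set B := Real.log (1 - t)
  have h6 := pow_nonneg h0 6
  have u1 := mul_le_mul_of_nonneg_left e1.1 (by linarith : 0 ≤ 1 - t)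
  have u2 := mul_le_mul_of_nonneg_left e1.2 (by linarith : 0 ≤ 1 - t)
  have u3 := mul_le_mul_of_nonneg_left e2.1 (by linarith : 0 ≤ 1 + t)
  have u4 := mul_le_mul_of_nonneg_left e2.2 (by linarith : 0 ≤ 1 + t)
  rw [abs_le]
  constructor <;> ring_nf at u1 u2 u3 u4 h6 ⊢ <;> linarith

/-- If `s² = t² + t⁴/6 + O(t⁶)` then `t = s - s³/12 + O(s⁵)`. -/
theorem abs_sub_cubic_le_of_abs_sq_sub_le {s t : ℝ} (hs : 0 < s) (h0 : 0 ≤ t) (h1 : t ≤ 1/6)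
    (h : |s ^ 2 - t ^ 2 - t ^ 4 / 6| ≤ 5 * t ^ 6) :
    |t - (s - s ^ 3 / 12)| ≤ 12 * s ^ 5 := by
  have t2 : t ^ 2 ≤ 1 / 36 := by nlinarith
  have t4 : 0 ≤ t ^ 4 := by positivity
  have t6 : 5 * t ^ 6 ≤ 5 / 36 * t ^ 4 := by nlinarith
  have h' := abs_le.1 h
  have hst : t ^ 2 ≤ s ^ 2 := by linarith
  have hst' : s ^ 2 - t ^ 2 ≤ t ^ 4 / 3 := by linarith
  have ts : t ≤ s := (pow_le_pow_iff_left₀ h0 hs.le two_ne_zero).1 hst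
  have ts4 : t ^ 4 ≤ s ^ 4 := pow_le_pow_left₀ h0 ts 4
  have ts6 : t ^ 6 ≤ s ^ 6 := pow_le_pow_left₀ h0 ts 6
  have s2 : s ^ 2 ≤ 1 := by nlinarith
  have s6 : 0 < s ^ 6 := by positivity
  have hp : s / 2 ≤ t + (s - s ^ 3 / 12) := by nlinarith
  have hd : (s ^ 2 - t ^ 2) * (s ^ 2 + t ^ 2) ≤ s ^ 4 / 3 * (2 * s ^ 2) :=
    mul_le_mul (by linarith) (by linarith) (by positivity) (by positivity)
  have hd0 : 0 ≤ (s ^ 2 - t ^ 2) * (s ^ 2 + t ^ 2) :=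
    mul_nonneg (by linarith) (by positivity)
  have hprod : |(t - (s - s ^ 3 / 12)) * (t + (s - s ^ 3 / 12))| ≤ 6 * s ^ 6 := by
    rw [show (t - (s - s ^ 3 / 12)) * (t + (s - s ^ 3 / 12)) =
      -(s ^ 2 - t ^ 2 - t ^ 4 / 6) + (s ^ 2 - t ^ 2) * (s ^ 2 + t ^ 2) / 6 - s ^ 6 / 144 by ring]
    have : s ^ 4 / 3 * (2 * s ^ 2) = 2 / 3 * s ^ 6 := by ring
    rw [abs_le]
    constructor <;> linarith
  rw [abs_mul, abs_of_pos (by linarith : 0 < t + (s - s ^ 3 / 12))] at hprod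
  have hm := mul_le_mul_of_nonneg_left hp (abs_nonneg (t - (s - s ^ 3 / 12)))
  refine le_of_mul_le_mul_right ?_ (by positivity : 0 < s / 2)
  calc _ ≤ 6 * s ^ 6 := hm.trans hprod
    _ = _ := by ring

theorem abs_binEntInv_log_two_sub_le {e : ℝ} (he : 0 < e)
    (he' : e < Real.log 2 - binEnt (7/12)) :
    |binEntInv (Real.log 2 - e) - (1/2 + (1 / Real.sqrt 2) * Real.sqrt e -
      (1 / (6 * Real.sqrt 2)) * e ^ ((3 : ℝ)/2))| ≤ 6 * Real.sqrt 2 ^ 5 * e ^ ((5 : ℝ)/2) := by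
  have hnn : 0 ≤ binEnt (7/12) := by
    rw [binEnt_eq_binEntropy]
    exact Real.binEntropy_nonneg (by norm_num) (by norm_num)
  have hmem := binEntInv_mem (y := Real.log 2 - e) (by linarith) (by linarith)
  have heq := binEnt_binEntInv (y := Real.log 2 - e) (by linarith) (by linarith)
  set x := binEntInv (Real.log 2 - e)
  have hx : x < 7/12 := by
    have hlt : binEnt (7/12) < binEnt x := by linarith
    rw [binEnt_eq_binEntropy] at hlt
    refine (Real.binEntropy_strictAntiOn.lt_iff_gt ?_ ?_).1 hlt
    · norm_num
    · rw [← one_div]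
      exact hmem
  have hr : 0 < Real.sqrt e := Real.sqrt_pos.2 he
  have hr2 : Real.sqrt e ^ 2 = e := Real.sq_sqrt he.le
  have hq : 0 < Real.sqrt 2 := by positivity
  have hq2 : Real.sqrt 2 ^ 2 = 2 := Real.sq_sqrt (by norm_num)
  have h3 : e ^ ((3 : ℝ)/2) = Real.sqrt e ^ 3 := by
    rw [Real.sqrt_eq_rpow, ← Real.rpow_mul_natCast he.le]
    norm_num
  have h5 : e ^ ((5 : ℝ)/2) = Real.sqrt e ^ 5 := by
    rw [Real.sqrt_eq_rpow, ← Real.rpow_mul_natCast he.le]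
    norm_num
  have hT := abs_log_two_sub_binEnt_sub_le (t := 2 * x - 1) (by linarith [hmem.1]) (by linarith)
  rw [show (1 + (2 * x - 1)) / 2 = x by ring, heq] at hT
  have hs2 : 2 * (Real.log 2 - (Real.log 2 - e)) = (Real.sqrt 2 * Real.sqrt e) ^ 2 := by
    rw [mul_pow, hq2, hr2]
    ring
  rw [hs2] at hT
  have main := abs_sub_cubic_le_of_abs_sq_sub_le (mul_pos hq hr) (by linarith [hmem.1])
    (by linarith) hT
  rw [h3, h5]
  have hi : 1 / Real.sqrt 2 = Real.sqrt 2 / 2 := by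
    rw [div_eq_div_iff hq.ne' two_ne_zero]
    linarith
  have hi6 : 1 / (6 * Real.sqrt 2) = Real.sqrt 2 ^ 3 / 24 := by
    rw [div_eq_div_iff (by positivity) (by norm_num)]
    linear_combination (-6 * Real.sqrt 2 ^ 2 - 12) * hq2
  rw [hi, hi6, show x - (1/2 + Real.sqrt 2 / 2 * Real.sqrt e - Real.sqrt 2 ^ 3 / 24 *
    Real.sqrt e ^ 3) = (2 * x - 1 - (Real.sqrt 2 * Real.sqrt e -
      (Real.sqrt 2 * Real.sqrt e) ^ 3 / 12)) / 2 by ring, abs_div, abs_two]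
  rw [mul_pow _ _ 5] at main
  linarith

/-- For positive `ε = ε_n → 0`,
`h⁻¹(log 2 − ε) = 1/2 + (1/√2)√ε − (1/(6√2))ε^{3/2} + O(ε^{5/2})`. -/
theorem binEntInv_taylor (ε : ℕ → ℝ) (hε : ∀ n, 0 < ε n)
    (hε0 : Tendsto ε atTop (nhds 0)) :
    ∃ M : ℝ, ∀ n : ℕ,
      |binEntInv (Real.log 2 - ε n) -
          (1/2 + (1 / Real.sqrt 2) * Real.sqrt (ε n) -
            (1 / (6 * Real.sqrt 2)) * (ε n) ^ ((3 : ℝ)/2))| ≤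
        M * (ε n) ^ ((5 : ℝ)/2) := by
  have hpos : 0 < Real.log 2 - binEnt (7/12) := by
    rw [binEnt_eq_binEntropy, sub_pos, Real.binEntropy_lt_log_two]
    norm_num
  have hev : ∀ᶠ n in atTop, |binEntInv (Real.log 2 - ε n) -
      (1/2 + (1 / Real.sqrt 2) * Real.sqrt (ε n) -
        (1 / (6 * Real.sqrt 2)) * (ε n) ^ ((3 : ℝ)/2))| / (ε n) ^ ((5 : ℝ)/2) ≤
      6 * Real.sqrt 2 ^ 5 := by
    filter_upwards [hε0.eventually_lt_const hpos] with n hn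
    rw [div_le_iff₀ (Real.rpow_pos_of_pos (hε n) _)]
    exact abs_binEntInv_log_two_sub_le (hε n) hn
  obtain ⟨M, hM⟩ := (isBoundedUnder_of_eventually_le hev).bddAbove_range
  refine ⟨M, fun n => ?_⟩
  rw [← div_le_iff₀ (Real.rpow_pos_of_pos (hε n) _)]
  exact hM ⟨n, rfl⟩

end
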